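/- Let X be a dendroid in the plane and x ∈ X. If X is colocally connected at x (i.e., for every open set V containing x there is an open U ⊂ V with x ∈ U and X \ U connected), then x is accessible from ℝ² \ X, meaning there exists an arc α ⊂ ℝ² such that α \ (ℝ² \ X) = α ∩ X = {x}. -/

import Mathlib

open Set Filter Topology

/-- The Euclidean plane. -/
abbrev Plane := EuclideanSpace ℝ (Fin 2)

section Defs

variable {α : Type*} [TopologicalSpace α]

/-- `A` is an arc with endpoints `a` and `b`: a homeomorphic image of `[0,1]`
sending `0 ↦ a` and `1 ↦ b`. -/
def IsArcWithEndpoints (A : Set α) (a b : α) : Prop :=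
  ∃ f : ℝ → α, ContinuousOn f (Set.Icc 0 1) ∧ Set.InjOn f (Set.Icc 0 1) ∧
    f '' (Set.Icc 0 1) = A ∧ f 0 = a ∧ f 1 = b

/-- `A` is an arc. -/
def IsArc (A : Set α) : Prop := ∃ a b, IsArcWithEndpoints A a b

/-- Every two distinct points of `X` are joined by an arc inside `X`. -/
def ArcwiseConnected (X : Set α) : Prop :=
  ∀ x ∈ X, ∀ y ∈ X, x ≠ y → ∃ A, A ⊆ X ∧ IsArcWithEndpoints A x y

/-- Every two subcontinua of `X` have connected intersection. -/
def HereditarilyUnicoherent (X : Set α) : Prop :=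
  ∀ K L : Set α, K ⊆ X → L ⊆ X → IsCompact K → IsConnected K →
    IsCompact L → IsConnected L → IsPreconnected (K ∩ L)

/-- A dendroid: a hereditarily unicoherent, arcwise connected continuum. -/
def IsDendroid (X : Set α) : Prop :=
  IsCompact X ∧ IsConnected X ∧ HereditarilyUnicoherent X ∧ ArcwiseConnected X

/-- The set of endpoints of `X`: points that are endpoints of every arc in `X`
containing them. -/
def Endpoints (X : Set α) : Set α :=
  {e | e ∈ X ∧ ∀ A : Set α, A ⊆ X → IsArc A → e ∈ A → ∃ b, IsArcWithEndpoints A e b}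

/-- `X` is Suslinian: every collection of pairwise-disjoint non-degenerate
subcontinua of `X` is countable. -/
def IsSuslinian (X : Set α) : Prop :=
  ∀ S : Set (Set α), (∀ K ∈ S, K ⊆ X ∧ IsCompact K ∧ IsConnected K ∧ K.Nontrivial) →
    S.PairwiseDisjoint id → S.Countable

/-- The arc component of `x` inside the set `S`. -/
def arcComponentIn (S : Set α) (x : α) : Set α :=
  {y | y ∈ S ∧ (y = x ∨ ∃ A, A ⊆ S ∧ IsArcWithEndpoints A x y)}

/-- The collection of arc components of `X \ {x}`; its cardinality is the order of `x`. -/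
def orderComponents (X : Set α) (x : α) : Set (Set α) :=
  {C | ∃ y ∈ X \ {x}, C = arcComponentIn (X \ {x}) y}

/-- Ramification points of `X`: points of order at least 3. -/
def RamificationPoints (X : Set α) : Set α :=
  {x | x ∈ X ∧ 3 ≤ (orderComponents X x).encard}

/-- `A` is a clopen subset of the subspace `Y`. -/
def IsClopenIn (Y A : Set α) : Prop :=
  A ⊆ Y ∧ (∃ U, IsOpen U ∧ A = Y ∩ U) ∧ (∃ C, IsClosed C ∧ A = Y ∩ C)

/-- The quasicomponent of `x` in the subspace `Y`: the intersection of all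
clopen subsets of `Y` containing `x`. -/
def quasicomponentIn (Y : Set α) (x : α) : Set α :=
  {y ∈ Y | ∀ A : Set α, IsClopenIn Y A → x ∈ A → y ∈ A}

/-- `Y` is hereditarily disconnected: it contains no non-degenerate connected subset. -/
def HereditarilyDisconnected (Y : Set α) : Prop :=
  ∀ S : Set α, S ⊆ Y → IsPreconnected S → S.Subsingleton

end Defs

/-- The point `x` of `X` is (arcwise) accessible from `ℝ² \ X`. -/
def AccessiblePoint (X : Set Plane) (x : Plane) : Prop :=
  ∃ A : Set Plane, IsArc A ∧ A ∩ X = {x}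

/-- `σ` separates the points `b` and `d` in the plane: no connected subset of the
complement of `σ` contains both. -/
def SeparatesPoints (σ : Set Plane) (b d : Plane) : Prop :=
  b ∉ σ ∧ d ∉ σ ∧ ∀ K : Set Plane, K ⊆ σᶜ → IsPreconnected K → b ∈ K → d ∉ K

/-- A simple closed curve in the plane: the image of a period-1 parametrization
injective on `[0,1)`. -/
def IsSimpleClosedCurve (O : Set Plane) : Prop :=
  ∃ f : ℝ → Plane, Continuous f ∧ Function.Periodic f 1 ∧
    Set.InjOn f (Set.Ico 0 1) ∧ f '' (Set.Ico 0 1) = O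

/-- The dendroid `X` is smooth at `p`: there is a choice `arcTo x` of the unique arc
from `x` to `p` (reduced to `{p}` for `x = p`) such that `xₙ → x` in `X` implies
`arcTo xₙ → arcTo x` in the Hausdorff distance. -/
def DendroidSmoothAt (X : Set Plane) (p : Plane) : Prop :=
  p ∈ X ∧ ∃ arcTo : Plane → Set Plane,
    arcTo p = {p} ∧
    (∀ x ∈ X, x ≠ p → arcTo x ⊆ X ∧ IsArcWithEndpoints (arcTo x) x p) ∧
    (∀ (xs : ℕ → Plane) (x : Plane), (∀ n, xs n ∈ X) → x ∈ X →
      Filter.Tendsto xs Filter.atTop (nhds x) →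
      Filter.Tendsto (fun n => EMetric.hausdorffEdist (arcTo (xs n)) (arcTo x))
        Filter.atTop (nhds 0))

/-- A space is zero-dimensional if it has a basis of clopen sets. -/
def IsZeroDimensionalSpace (β : Type*) [TopologicalSpace β] : Prop :=
  ∀ (x : β) (U : Set β), IsOpen U → x ∈ U → ∃ V : Set β, IsClopen V ∧ x ∈ V ∧ V ⊆ U

/-- A space is almost zero-dimensional if it has a neighborhood basis of sets
which are intersections of clopen sets. -/
def IsAlmostZeroDimensionalSpace (β : Type*) [TopologicalSpace β] : Prop :=
  ∀ (x : β) (U : Set β), IsOpen U → x ∈ U →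
    ∃ V : Set β, V ∈ nhds x ∧ V ⊆ U ∧
      ∃ 𝒞 : Set (Set β), (∀ C ∈ 𝒞, IsClopen C) ∧ V = ⋂₀ 𝒞

/-- The union of `W` with all of the bounded connected components of its complement. -/
def boundedComplementaryFill (W : Set Plane) : Set Plane :=
  W ∪ ⋃₀ {K | (∃ x ∈ Wᶜ, K = connectedComponentIn Wᶜ x) ∧ Bornology.IsBounded K}

/-- A Bellamy dendroid: a (non-degenerate) smooth plane dendroid whose endpoint
set is connected. -/
def IsBellamyDendroid (K : Set Plane) : Prop :=
  IsDendroid K ∧ K.Nontrivial ∧ (∃ q, DendroidSmoothAt K q) ∧ IsConnected (Endpoints K)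

/-- The middle-thirds Cantor set. -/
noncomputable def cantorC : Set ℝ :=
  {x | ∃ a : ℕ → Bool, x = ∑' i, (if a i then (2 : ℝ) else 0) / 3 ^ (i + 1)}

/-- `h` has a continuous logarithm on `s`. -/
def HasLogOn (s : Set ℂ) (h : ℂ → ℂ) : Prop :=
  ∃ g : ℂ → ℂ, ContinuousOn g s ∧ ∀ z ∈ s, Complex.exp (g z) = h z

theorem sub_eq_const_of_exp_eq {α : Type*} [TopologicalSpace α] {s : Set α}
    (hs : IsPreconnected s) {f g : α → ℂ} (hf : ContinuousOn f s) (hg : ContinuousOn g s)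
    (h : ∀ z ∈ s, Complex.exp (f z) = Complex.exp (g z)) {z w : α} (hz : z ∈ s) (hw : w ∈ s) :
    f z - g z = f w - g w := by
  have key : ∀ z ∈ s, ∃ n : ℤ, f z - g z = n * (2 * Real.pi * Complex.I) := fun z hz => by
    obtain ⟨n, hn⟩ := Complex.exp_eq_exp_iff_exists_int.1 (h z hz)
    exact ⟨n, by rw [hn]; ring⟩
  have hpi : (2 * Real.pi * Complex.I : ℂ) ≠ 0 := Complex.two_pi_I_ne_zero
  have hc : ContinuousOn (fun z => ((f z - g z) / (2 * Real.pi * Complex.I)).re) s :=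
    Complex.continuous_re.comp_continuousOn ((hf.sub hg).div_const _)
  have hd : DiscreteTopology (range ((↑) : ℤ → ℝ)) :=
    (Int.isClosedEmbedding_coe_real.isEmbedding.toHomeomorph).symm.isEmbedding.discreteTopology
  have hm : MapsTo (fun z => ((f z - g z) / (2 * Real.pi * Complex.I)).re) s
      (range ((↑) : ℤ → ℝ)) := by
    intro z hz
    obtain ⟨n, hn⟩ := key z hz
    refine ⟨n, ?_⟩
    simp only [hn, mul_div_cancel_right₀ _ hpi, Complex.intCast_re]
  have := hs.constant_of_mapsTo (isDiscrete_iff_discreteTopology.2 hd) hc hm hz hw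
  obtain ⟨n, hn⟩ := key z hz
  obtain ⟨m, hmw⟩ := key w hw
  simp only [hn, hmw, mul_div_cancel_right₀ _ hpi, Complex.intCast_re, Int.cast_inj] at this
  rw [hn, hmw, this]

theorem hasLogOn_closedBall {p : ℂ} {R : ℝ} {h : ℂ → ℂ} (hR : 0 < R)
    (hc : ContinuousOn h (Metric.closedBall p R)) (h0 : ∀ z ∈ Metric.closedBall p R, h z ≠ 0) :
    HasLogOn (Metric.closedBall p R) h := by
  have hcomp : IsCompact (Metric.closedBall p R) := isCompact_closedBall p R
  have hp : p ∈ Metric.closedBall p R := Metric.mem_closedBall_self hR.le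
  obtain ⟨z₀, hz₀, hmin⟩ := hcomp.exists_isMinOn ⟨p, hp⟩ hc.norm
  have hm : 0 < ‖h z₀‖ := norm_pos_iff.2 (h0 z₀ hz₀)
  obtain ⟨δ, hδ, huc⟩ := Metric.uniformContinuousOn_iff.1
    (hcomp.uniformContinuousOn_of_continuous hc) _ hm
  obtain ⟨n, hn⟩ := exists_nat_gt (R / δ)
  have hn0 : (0 : ℝ) < n := lt_of_le_of_lt (by positivity) hn
  let u : ℕ → ℂ → ℂ := fun k z => p + ((k / n : ℝ) : ℂ) * (z - p)
  have hu : ∀ k ≤ n, ∀ z ∈ Metric.closedBall p R, u k z ∈ Metric.closedBall p R := by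
    intro k hk z hz
    have h1 : (k / n : ℝ) ≤ 1 := (div_le_one hn0).2 (by exact_mod_cast hk)
    have h2 : (0 : ℝ) ≤ k / n := by positivity
    rw [mem_closedBall_iff_norm] at hz ⊢
    simp only [u, add_sub_cancel_left, norm_mul, Complex.norm_real, Real.norm_of_nonneg h2]
    nlinarith [norm_nonneg (z - p)]
  have hucont : ∀ k, Continuous (u k) := fun k => by fun_prop
  have hstep : ∀ k < n, ∀ z ∈ Metric.closedBall p R,
      h (u (k + 1) z) / h (u k z) ∈ Complex.slitPlane := by
    intro k hk z hz
    have a := hu k hk.le z hz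
    have b := hu (k + 1) hk z hz
    have hd : dist (u (k + 1) z) (u k z) < δ := by
      have : u (k + 1) z - u k z = ((1 / n : ℝ) : ℂ) * (z - p) := by
        simp only [u]; push_cast; ring
      rw [dist_eq_norm, this, norm_mul, Complex.norm_real, Real.norm_of_nonneg (by positivity)]
      rw [mem_closedBall_iff_norm] at hz
      rw [div_lt_iff₀ hδ] at hn
      rw [one_div_mul_eq_div, div_lt_iff₀ hn0]
      nlinarith
    have h2 := huc _ b _ a hd
    have h3 : ‖h z₀‖ ≤ ‖h (u k z)‖ := hmin a
    have h4 := h0 _ a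
    have : h (u (k + 1) z) / h (u k z) = 1 + (h (u (k + 1) z) - h (u k z)) / h (u k z) := by
      field_simp; ring
    rw [this]
    apply Complex.mem_slitPlane_of_norm_lt_one
    rw [norm_div, div_lt_one (norm_pos_iff.2 h4), ← dist_eq_norm]
    linarith
  have hmaps : ∀ k ≤ n, ContinuousOn (fun z => h (u k z)) (Metric.closedBall p R) := fun k hk =>
    hc.comp (hucont k).continuousOn (hu k hk)
  refine ⟨fun z => Complex.log (h p) +
    ∑ k ∈ Finset.range n, Complex.log (h (u (k + 1) z) / h (u k z)), ?_, ?_⟩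
  · refine continuousOn_const.add (continuousOn_finsetSum _ fun k hk => ?_)
    have hk := Finset.mem_range.1 hk
    exact ContinuousOn.clog ((hmaps _ hk).div (hmaps _ hk.le)
      fun z hz => h0 _ (hu _ hk.le z hz)) (hstep k hk)
  · intro z hz
    have : ∀ j ≤ n, Complex.exp (Complex.log (h p) +
        ∑ k ∈ Finset.range j, Complex.log (h (u (k + 1) z) / h (u k z))) = h (u j z) := by
      intro j
      induction j with
      | zero => intro _; simp [u, Complex.exp_log (h0 p hp)]
      | succ j ih =>
        intro hj
        have a := h0 _ (hu j (by omega) z hz)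
        have b := h0 _ (hu (j + 1) hj z hz)
        rw [Finset.sum_range_succ, ← add_assoc, Complex.exp_add, ih (by omega),
          Complex.exp_log (div_ne_zero b a)]
        field_simp
    have h1 := this n le_rfl
    have h2 : u n z = z := by
      have : (n : ℂ) ≠ 0 := by exact_mod_cast hn0.ne'
      simp [u, div_self this]
    rwa [h2] at h1

theorem no_nonvanishing_extension {p : ℂ} {R : ℝ} {h : ℂ → ℂ} (hR : 0 < R)
    (hc : ContinuousOn h (Metric.closedBall p R)) (h0 : ∀ z ∈ Metric.closedBall p R, h z ≠ 0)
    (hb : ∀ z ∈ Metric.sphere p R, h z = z - p) : False := by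
  obtain ⟨g, hg, hexp⟩ := hasLogOn_closedBall hR hc h0
  have hmem : ∀ t : ℝ, circleMap p R t ∈ Metric.sphere p R := circleMap_mem_sphere p hR.le
  have hcont : Continuous fun t : ℝ => g (circleMap p R t) :=
    hg.comp_continuous (continuous_circleMap p R)
      fun t => Metric.sphere_subset_closedBall (hmem t)
  have := sub_eq_const_of_exp_eq (s := univ) isPreconnected_univ
    (f := fun t : ℝ => g (circleMap p R t))
    (g := fun t : ℝ => Complex.log R + t * Complex.I) hcont.continuousOn (by fun_prop)
    (fun t _ => by
      rw [hexp _ (Metric.sphere_subset_closedBall (hmem t)), hb _ (hmem t), Complex.exp_add,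
        Complex.exp_log (by exact_mod_cast hR.ne')]
      simp [circleMap]) (mem_univ 0) (mem_univ (2 * Real.pi))
  have h2 : circleMap p R (2 * Real.pi) = circleMap p R 0 := by
    simpa using (periodic_circleMap p R) 0
  simp only [h2] at this
  have h3 := congrArg Complex.im this
  simp at h3

theorem hasLogOn_of_joinedIn {A : Set ℂ} (hA : IsClosed A) {p q : ℂ} (h : JoinedIn Aᶜ p q) :
    HasLogOn A fun z => (z - p) / (z - q) := by
  have hs : IsPreconnected (pathComponentIn Aᶜ p) :=
    (isPathConnected_pathComponentIn h.source_mem).isConnected.isPreconnected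
  have hsub : pathComponentIn Aᶜ p ⊆ Aᶜ := pathComponentIn_subset
  have hne : ∀ a ∈ pathComponentIn Aᶜ p, ∀ z ∈ A, z - a ≠ 0 := fun a ha z hz e =>
    hsub ha (sub_eq_zero.1 e ▸ hz)
  refine hs.induction₂ (fun p q => HasLogOn A fun z => (z - p) / (z - q)) ?_ ?_ ?_
    (mem_pathComponentIn_self h.source_mem) h
  · intro a ha
    obtain ⟨r, hr, hball⟩ := Metric.isOpen_iff.1 hA.isOpen_compl a (hsub ha)
    refine mem_nhdsWithin_of_mem_nhds (Filter.mem_of_superset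
      (Metric.ball_mem_nhds a (half_pos hr)) fun b hb => ?_)
    have hb' : dist b a < r / 2 := hb
    have hfar : ∀ z ∈ A, dist b a < dist z b := by
      intro z hz
      have : r ≤ dist z a := by
        by_contra hlt
        exact hball (Metric.mem_ball.2 (not_le.1 hlt)) hz
      linarith [dist_triangle z b a]
    have hzb : ∀ z ∈ A, z - b ≠ 0 := fun z hz e => by
      have := hfar z hz
      rw [sub_eq_zero.1 e, dist_self] at this
      exact absurd this (not_lt.2 dist_nonneg)
    have hslit : ∀ z ∈ A, (z - a) / (z - b) ∈ Complex.slitPlane := by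
      intro z hz
      have h1 := hzb z hz
      have : (z - a) / (z - b) = 1 + (b - a) / (z - b) := by field_simp; ring
      rw [this]
      apply Complex.mem_slitPlane_of_norm_lt_one
      rw [norm_div, div_lt_one (norm_pos_iff.2 h1), ← dist_eq_norm, ← dist_eq_norm]
      exact hfar z hz
    exact ⟨fun z => Complex.log ((z - a) / (z - b)),
      ContinuousOn.clog (ContinuousOn.div (by fun_prop) (by fun_prop) hzb) hslit,
      fun z hz => Complex.exp_log (Complex.slitPlane_ne_zero (hslit z hz))⟩
  · rintro a b c ha hb hc ⟨g₁, hg₁, h₁⟩ ⟨g₂, hg₂, h₂⟩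
    refine ⟨fun z => g₁ z + g₂ z, hg₁.add hg₂, fun z hz => ?_⟩
    rw [Complex.exp_add, h₁ z hz, h₂ z hz]
    have := hne b hb z hz
    have := hne c hc z hz
    field_simp
  · rintro a b ha hb ⟨g, hg, h⟩
    refine ⟨fun z => - g z, hg.neg, fun z hz => ?_⟩
    rw [Complex.exp_neg, h z hz, inv_div]

theorem not_isBounded_pathComponentIn {A : Set ℂ} (hA : IsClosed A) {p q : ℂ} (hp : p ∉ A)
    (hq : q ∉ A) (hlog : HasLogOn A fun z => (z - p) / (z - q)) (hn : ¬ JoinedIn Aᶜ p q) :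
    ¬ Bornology.IsBounded (pathComponentIn Aᶜ p) := by
  classical
  intro hbd
  obtain ⟨g, hg, hexp⟩ := hlog
  set C := pathComponentIn Aᶜ p with hC
  have hCo : IsOpen C := hA.isOpen_compl.pathComponentIn p
  have hpC : p ∈ C := mem_pathComponentIn_self hp
  have hfr : frontier C ⊆ A := by
    intro z hz
    by_contra hzA
    have hz' : z ∈ closure C := frontier_subset_closure hz
    obtain ⟨w, hw₁, hw₂⟩ := mem_closure_iff.1 hz' (pathComponentIn Aᶜ z)
      (hA.isOpen_compl.pathComponentIn z) (mem_pathComponentIn_self hzA)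
    have : z ∈ C := JoinedIn.trans hw₂ (JoinedIn.symm hw₁)
    rw [hCo.frontier_eq] at hz
    exact hz.2 this
  obtain ⟨G, hG⟩ := ContinuousMap.exists_restrict_eq hA ⟨A.domRestrict g, hg.domRestrict⟩
  have hG' : ∀ z ∈ A, G z = g z := fun z hz => congrArg (fun f : C(A, ℂ) => f ⟨z, hz⟩) hG
  obtain ⟨R, hR, hball⟩ := hbd.subset_ball_lt 0 p
  let h : ℂ → ℂ := fun z => if z ∈ C then (z - q) * Complex.exp (G z) else z - p
  have hcont : Continuous h := by
    refine Continuous.if (fun z hz => ?_) (by fun_prop) (by fun_prop)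
    have hz' : z ∈ A := hfr hz
    have : z - q ≠ 0 := fun e => hq (sub_eq_zero.1 e ▸ hz')
    rw [hG' z hz', hexp z hz']
    field_simp
  refine no_nonvanishing_extension (p := p) hR hcont.continuousOn (fun z _ => ?_) (fun z hz => ?_)
  · by_cases hzC : z ∈ C
    · simp only [h, hzC, if_true]
      refine mul_ne_zero (fun e => hn ?_) (Complex.exp_ne_zero _)
      rw [← sub_eq_zero.1 e]
      exact hzC
    · simp only [h, hzC, if_false]
      exact fun e => hzC (sub_eq_zero.1 e ▸ hpC)
  · have hzC : z ∉ C := fun hzC => (Metric.mem_ball.1 (hball hzC)).ne hz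
    simp only [h, hzC, if_false]

theorem joinedIn_compl_closedBall {R : ℝ} (hR : 0 ≤ R) {a b : ℂ} (ha : R < ‖a‖) (hb : R < ‖b‖) :
    JoinedIn (Metric.closedBall (0 : ℂ) R)ᶜ a b := by
  have hs : IsPathConnected (Metric.sphere (0 : ℂ) 1) :=
    isPathConnected_sphere (by simp) 0 zero_le_one
  have hi : IsPathConnected (Ioi R) := (convex_Ioi R).isPathConnected ⟨R + 1, by simp⟩
  have hpc := (hi.prod hs).image (f := fun x : ℝ × ℂ => (x.1 : ℂ) * x.2) (by fun_prop)
  have hmem : ∀ a : ℂ, R < ‖a‖ → a ∈ (fun x : ℝ × ℂ => (x.1 : ℂ) * x.2) ''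
      (Ioi R ×ˢ Metric.sphere (0 : ℂ) 1) := by
    intro a ha
    have h0 : ‖a‖ ≠ 0 := (hR.trans_lt ha).ne'
    have h0' : (‖a‖ : ℂ) ≠ 0 := by exact_mod_cast h0
    refine ⟨(‖a‖, a / ‖a‖), ⟨ha, ?_⟩, ?_⟩
    · simp [h0]
    · simp only; field_simp
  refine (hpc.joinedIn a (hmem a ha) b (hmem b hb)).mono ?_
  rintro _ ⟨⟨r, u⟩, ⟨hr, hu⟩, rfl⟩
  have hr : R < r := hr
  have hu : ‖u‖ = 1 := by simpa using hu
  simp [hu, abs_of_pos (hR.trans_lt hr), hr]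

theorem joinedIn_of_hasLogOn {A : Set ℂ} (hA : IsCompact A) {p q : ℂ} (hp : p ∉ A)
    (hq : q ∉ A) (hlog : HasLogOn A fun z => (z - p) / (z - q)) : JoinedIn Aᶜ p q := by
  by_contra hn
  have hlog' : HasLogOn A fun z => (z - q) / (z - p) := by
    obtain ⟨g, hg, hexp⟩ := hlog
    exact ⟨fun z => - g z, hg.neg, fun z hz => by rw [Complex.exp_neg, hexp z hz, inv_div]⟩
  have h₁ := not_isBounded_pathComponentIn hA.isClosed hp hq hlog hn
  have h₂ := not_isBounded_pathComponentIn hA.isClosed hq hp hlog' fun h => hn h.symm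
  obtain ⟨R, hR, hball⟩ := hA.isBounded.subset_closedBall_lt 0 0
  have key : ∀ S : Set ℂ, ¬ Bornology.IsBounded S → ∃ a ∈ S, R < ‖a‖ := by
    intro S hS
    by_contra! hall
    exact hS (Metric.isBounded_closedBall.subset fun a ha => mem_closedBall_zero_iff.2 (hall a ha))
  obtain ⟨a, ha, ha'⟩ := key _ h₁
  obtain ⟨b, hb, hb'⟩ := key _ h₂
  have hab := (joinedIn_compl_closedBall hR.le ha' hb').mono (compl_subset_compl.2 hball)
  exact hn ((JoinedIn.trans ha hab).trans (JoinedIn.symm hb))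

theorem hasLogOn_union {A B : Set ℂ} (hA : IsClosed A) (hB : IsClosed B)
    (hAB : IsPreconnected (A ∩ B)) {h : ℂ → ℂ} (h₁ : HasLogOn A h) (h₂ : HasLogOn B h) :
    HasLogOn (A ∪ B) h := by
  classical
  obtain ⟨g₁, hg₁, he₁⟩ := h₁
  obtain ⟨g₂, hg₂, he₂⟩ := h₂
  obtain ⟨c, hc, hc'⟩ : ∃ c : ℂ, (∀ z ∈ A ∩ B, g₁ z = g₂ z + c) ∧ Complex.exp c = 1 := by
    rcases (A ∩ B).eq_empty_or_nonempty with h0 | ⟨w, hw⟩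
    · exact ⟨0, by simp [h0], Complex.exp_zero⟩
    · have heq : ∀ z ∈ A ∩ B, Complex.exp (g₁ z) = Complex.exp (g₂ z) := fun z hz => by
        rw [he₁ z hz.1, he₂ z hz.2]
      refine ⟨g₁ w - g₂ w, fun z hz => ?_, ?_⟩
      · rw [← sub_eq_const_of_exp_eq hAB (hg₁.mono inter_subset_left)
          (hg₂.mono inter_subset_right) heq hz hw]
        ring
      · rw [Complex.exp_sub, heq w hw, div_self (Complex.exp_ne_zero _)]
  have hfB : ∀ z ∈ B, A.piecewise g₁ (fun z => g₂ z + c) z = g₂ z + c := by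
    intro z hz
    by_cases hzA : z ∈ A
    · rw [piecewise_eq_of_mem _ _ _ hzA, hc z ⟨hzA, hz⟩]
    · rw [piecewise_eq_of_notMem _ _ _ hzA]
  have hfA : ∀ z ∈ A, A.piecewise g₁ (fun z => g₂ z + c) z = g₁ z := fun z hz =>
    piecewise_eq_of_mem _ _ _ hz
  refine ⟨A.piecewise g₁ fun z => g₂ z + c, ?_, ?_⟩
  · exact (hg₁.congr hfA).union_of_isClosed
      ((hg₂.add continuousOn_const).congr hfB) hA hB
  · rintro z (hz | hz)
    · rw [hfA z hz, he₁ z hz]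
    · rw [hfB z hz, Complex.exp_add, hc', mul_one, he₂ z hz]

/-- Janiszewski's theorem in `ℂ`. -/
theorem joinedIn_compl_union_complex {A B : Set ℂ} (hA : IsCompact A) (hB : IsCompact B)
    (hAB : IsPreconnected (A ∩ B)) {p q : ℂ} (h₁ : JoinedIn Aᶜ p q) (h₂ : JoinedIn Bᶜ p q) :
    JoinedIn (A ∪ B)ᶜ p q :=
  joinedIn_of_hasLogOn (hA.union hB) (fun h => h.elim h₁.source_mem h₂.source_mem)
    (fun h => h.elim h₁.target_mem h₂.target_mem)
    (hasLogOn_union hA.isClosed hB.isClosed hAB (hasLogOn_of_joinedIn hA.isClosed h₁)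
      (hasLogOn_of_joinedIn hB.isClosed h₂))

/-- Janiszewski's theorem in the Euclidean plane. -/
theorem joinedIn_compl_union {A B : Set Plane} (hA : IsCompact A) (hB : IsCompact B)
    (hAB : IsPreconnected (A ∩ B)) {p q : EuclideanSpace ℝ (Fin 2)} (h₁ : JoinedIn Aᶜ p q)
    (h₂ : JoinedIn Bᶜ p q) : JoinedIn (A ∪ B)ᶜ p q := by
  let e : EuclideanSpace ℝ (Fin 2) ≃ₜ ℂ := Complex.orthonormalBasisOneI.repr.symm.toHomeomorph
  have key := joinedIn_compl_union_complex (hA.image e.continuous) (hB.image e.continuous)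
    (by rw [← image_inter e.injective]; exact hAB.image _ e.continuous.continuousOn)
    (by rw [← image_compl_eq e.bijective]; exact h₁.map e.continuous)
    (by rw [← image_compl_eq e.bijective]; exact h₂.map e.continuous)
  rw [← image_union, ← image_compl_eq e.bijective] at key
  simpa [image_image] using key.map e.symm.continuous
theorem IsArcWithEndpoints.isCompact {α : Type*} [TopologicalSpace α] {T : Set α} {a b : α}
    (h : IsArcWithEndpoints T a b) : IsCompact T := by
  obtain ⟨f, hf, -, rfl, -, -⟩ := h
  exact isCompact_Icc.image_of_continuousOn hf

theorem IsArcWithEndpoints.isConnected {α : Type*} [TopologicalSpace α] {T : Set α} {a b : α}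
    (h : IsArcWithEndpoints T a b) : IsConnected T := by
  obtain ⟨f, hf, -, rfl, -, -⟩ := h
  exact (isConnected_Icc zero_le_one).image _ hf

theorem IsArcWithEndpoints.subset_of_mem {α : Type*} [TopologicalSpace α] [T2Space α]
    {X K T : Set α} {a b : α} (hX : HereditarilyUnicoherent X) (hK : K ⊆ X) (hKc : IsCompact K)
    (hKconn : IsConnected K) (hT : T ⊆ X) (h : IsArcWithEndpoints T a b) (ha : a ∈ K)
    (hb : b ∈ K) : T ⊆ K := by
  have hpre : IsPreconnected (T ∩ K) := hX T K hT hK h.isCompact h.isConnected hKc hKconn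
  obtain ⟨f, hf, hinj, rfl, rfl, rfl⟩ := h
  rintro _ ⟨t, ht, rfl⟩
  by_contra htK
  have h0 : (0 : ℝ) ∈ Icc (0 : ℝ) 1 := left_mem_Icc.2 zero_le_one
  have h1 : (1 : ℝ) ∈ Icc (0 : ℝ) 1 := right_mem_Icc.2 zero_le_one
  have hs₁ : Icc 0 t ⊆ Icc (0 : ℝ) 1 := Icc_subset_Icc_right ht.2
  have hs₂ : Icc t 1 ⊆ Icc (0 : ℝ) 1 := Icc_subset_Icc_left ht.1
  obtain ⟨y, ⟨-, hyK⟩, ⟨u, hu, rfl⟩, ⟨v, hv, hvu⟩⟩ := isPreconnected_closed_iff.1 hpre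
    (f '' Icc 0 t) (f '' Icc t 1)
    (isCompact_Icc.image_of_continuousOn (hf.mono hs₁)).isClosed
    (isCompact_Icc.image_of_continuousOn (hf.mono hs₂)).isClosed
    (by
      rw [← image_union, Icc_union_Icc_eq_Icc ht.1 ht.2]
      exact inter_subset_left)
    ⟨f 0, ⟨mem_image_of_mem _ h0, ha⟩, mem_image_of_mem _ (left_mem_Icc.2 ht.1)⟩
    ⟨f 1, ⟨mem_image_of_mem _ h1, hb⟩, mem_image_of_mem _ (right_mem_Icc.2 ht.2)⟩
  have huv : v = u := hinj (hs₂ hv) (hs₁ hu) hvu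
  subst huv
  have : v = t := le_antisymm hu.2 hv.1
  exact htK (this ▸ hyK)

/-- An arc is the union of two proper subcontinua. -/
theorem IsArcWithEndpoints.exists_decomposition {α : Type*} [TopologicalSpace α] {T : Set α}
    {a b : α} (h : IsArcWithEndpoints T a b) :
    ∃ P Q : Set α, IsCompact P ∧ IsConnected P ∧ IsCompact Q ∧ IsConnected Q ∧
      P ∪ Q = T ∧ P ≠ T ∧ Q ≠ T := by
  obtain ⟨f, hf, hinj, rfl, -, -⟩ := h
  have h0 : (0 : ℝ) ∈ Icc (0 : ℝ) 1 := left_mem_Icc.2 zero_le_one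
  have h1 : (1 : ℝ) ∈ Icc (0 : ℝ) 1 := right_mem_Icc.2 zero_le_one
  have hs₁ : Icc 0 (1 / 2) ⊆ Icc (0 : ℝ) 1 := Icc_subset_Icc_right (by norm_num)
  have hs₂ : Icc (1 / 2) 1 ⊆ Icc (0 : ℝ) 1 := Icc_subset_Icc_left (by norm_num)
  refine ⟨f '' Icc 0 (1 / 2), f '' Icc (1 / 2) 1,
    isCompact_Icc.image_of_continuousOn (hf.mono hs₁),
    (isConnected_Icc (by norm_num)).image _ (hf.mono hs₁),
    isCompact_Icc.image_of_continuousOn (hf.mono hs₂),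
    (isConnected_Icc (by norm_num)).image _ (hf.mono hs₂), ?_, fun h => ?_, fun h => ?_⟩
  · rw [← image_union, Icc_union_Icc_eq_Icc (by norm_num) (by norm_num)]
  · obtain ⟨t, ht, hft⟩ := h.symm.subset (mem_image_of_mem f h1)
    have := hinj (hs₁ ht) h1 hft
    have := ht.2
    linarith
  · obtain ⟨t, ht, hft⟩ := h.symm.subset (mem_image_of_mem f h0)
    have := hinj (hs₂ ht) h0 hft
    have := ht.1
    linarith

/-- A compact set failing to join `p` and `q` in its complement contains a minimal such set. -/
theorem exists_minimal_not_joinedIn_compl {α : Type*} [TopologicalSpace α] [T2Space α] {X : Set α}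
    (hX : IsCompact X) {p q : α} (h : ¬ JoinedIn Xᶜ p q) :
    ∃ K ⊆ X, IsClosed K ∧ ¬ JoinedIn Kᶜ p q ∧
      ∀ L ⊆ K, IsClosed L → L ≠ K → JoinedIn Lᶜ p q := by
  obtain ⟨K, hKX, hK⟩ := zorn_superset_nonempty
    {σ : Set α | σ ⊆ X ∧ IsClosed σ ∧ ¬ JoinedIn σᶜ p q} (fun c hc hchain hne => by
      refine ⟨⋂₀ c, ⟨?_, isClosed_sInter fun s hs => (hc hs).2.1, fun hj => ?_⟩,
        fun s hs => sInter_subset_of_mem hs⟩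
      · obtain ⟨s, hs⟩ := hne
        exact (sInter_subset_of_mem hs).trans (hc hs).1
      · obtain ⟨γ, hγ⟩ := hj
        have hcomp : IsCompact (range γ) := isCompact_range γ.continuous
        have hempty : range γ ∩ ⋂₀ c = ∅ := by
          rw [← disjoint_iff_inter_eq_empty, disjoint_left]
          rintro _ ⟨t, rfl⟩
          exact hγ t
        have : Nonempty c := hne.to_subtype
        obtain ⟨s, hs⟩ := hcomp.elim_directed_family_closed
          (fun s : c => (s : Set α)) (fun s => (hc s.2).2.1) (by rwa [← sInter_eq_iInter])
          (by
            rintro ⟨s, hs⟩ ⟨t, ht⟩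
            rcases hchain.total hs ht with hst | hst
            · exact ⟨⟨s, hs⟩, subset_rfl, hst⟩
            · exact ⟨⟨t, ht⟩, hst, subset_rfl⟩)
        exact (hc s.2).2.2 ⟨γ, fun t ht => by
          have : γ t ∈ range γ ∩ (s : Set α) := ⟨⟨t, rfl⟩, ht⟩
          rw [hs] at this
          exact this⟩) X ⟨subset_rfl, hX.isClosed, h⟩
  exact ⟨K, hKX, hK.prop.2.1, hK.prop.2.2, fun L hLK hL hne => by
    by_contra hj
    exact hne (hLK.antisymm (hK.le_of_le ⟨hLK.trans hKX, hL, hj⟩ hLK))⟩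

/-- In an indecomposable continuum every proper subcontinuum has dense complement. -/
theorem closure_diff_eq_of_indecomposable {α : Type*} [TopologicalSpace α] [T2Space α]
    {K A : Set α} (hK : IsCompact K) (hKc : IsConnected K)
    (hind : ∀ P Q : Set α, IsCompact P → IsConnected P → IsCompact Q → IsConnected Q →
      P ∪ Q = K → P = K ∨ Q = K)
    (hA : IsCompact A) (hAc : IsConnected A) (hAK : A ⊆ K) (hne : A ≠ K) :
    closure (K \ A) = K := by
  have hLK : closure (K \ A) ⊆ K := closure_minimal sdiff_subset hK.isClosed
  have hLcl : IsClosed (closure (K \ A)) := isClosed_closure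
  have hLne : (K \ A).Nonempty := by
    by_contra h
    rw [not_nonempty_iff_eq_empty, sdiff_eq_empty] at h
    exact hne (hAK.antisymm h)
  have hun : A ∪ closure (K \ A) = K := by
    refine (union_subset hAK hLK).antisymm fun z hz => ?_
    by_cases hzA : z ∈ A
    · exact Or.inl hzA
    · exact Or.inr (subset_closure ⟨hz, hzA⟩)
  by_cases hconn : IsPreconnected (closure (K \ A))
  · exact (hind A _ hA hAc (hK.of_isClosed_subset hLcl hLK) ⟨hLne.closure, hconn⟩ hun).resolve_left
      hne
  · exfalso
    rw [isPreconnected_iff_subset_of_fully_disjoint_closed hLcl] at hconn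
    push Not at hconn
    obtain ⟨P, Q, hP, hQ, hPQ, hdisj, hnP, hnQ⟩ := hconn
    have main : ∀ P Q : Set α, IsClosed P → IsClosed Q → closure (K \ A) ⊆ P ∪ Q →
        Disjoint P Q → ¬ closure (K \ A) ⊆ P →
        IsCompact (A ∪ P ∩ closure (K \ A)) ∧ IsConnected (A ∪ P ∩ closure (K \ A)) ∧
          A ∪ P ∩ closure (K \ A) ≠ K := by
      intro P Q hP hQ hPQ hdisj hnP
      have hcl : IsClosed (A ∪ P ∩ closure (K \ A)) := hA.isClosed.union (hP.inter hLcl)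
      refine ⟨hK.of_isClosed_subset hcl
        (union_subset hAK (inter_subset_right.trans hLK)), ⟨hAc.nonempty.inl, ?_⟩, fun heq => ?_⟩
      · rw [isPreconnected_iff_subset_of_fully_disjoint_closed hcl]
        have side : ∀ M N : Set α, IsClosed M → IsClosed N →
            A ∪ P ∩ closure (K \ A) ⊆ M ∪ N → Disjoint M N → A ⊆ M →
            A ∪ P ∩ closure (K \ A) ⊆ M := by
          intro M N hM hN hMN hd hAM
          refine union_subset hAM fun z hz => ?_
          by_contra hzM
          have hzN : z ∈ N := (hMN (Or.inr hz)).resolve_left hzM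
          have hsub := (isPreconnected_iff_subset_of_fully_disjoint_closed hK.isClosed).1
            hKc.isPreconnected (N ∩ (P ∩ closure (K \ A))) (M ∪ Q)
            (hN.inter (hP.inter hLcl)) (hM.union hQ) (fun w hw => by
              rw [← hun] at hw
              rcases hw with hw | hw
              · exact Or.inr (Or.inl (hAM hw))
              · rcases hPQ hw with hwP | hwQ
                · rcases hMN (Or.inr ⟨hwP, hw⟩) with h | h
                  · exact Or.inr (Or.inl h)
                  · exact Or.inl ⟨h, hwP, hw⟩
                · exact Or.inr (Or.inr hwQ))
            (by
              rw [disjoint_left]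
              rintro w ⟨hwN, hwP, -⟩ (hwM | hwQ)
              · exact disjoint_left.1 hd hwM hwN
              · exact disjoint_left.1 hdisj hwP hwQ)
          rcases hsub with hsub | hsub
          · obtain ⟨w, hw⟩ := hAc.nonempty
            exact disjoint_left.1 hd (hAM hw) (hsub (hAK hw)).1
          · rcases hsub (hLK hz.2) with h | h
            · exact hzM h
            · exact disjoint_left.1 hdisj hz.1 h
        intro M N hM hN hMN hd
        rcases (isPreconnected_iff_subset_of_fully_disjoint_closed hA.isClosed).1
          hAc.isPreconnected M N hM hN (subset_union_left.trans hMN) hd with h | h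
        · exact Or.inl (side M N hM hN hMN hd h)
        · exact Or.inr (side N M hN hM (by rwa [union_comm N M]) hd.symm h)
      · refine hnP (closure_minimal (fun z hz => ?_) hP)
        rw [← heq] at hz
        exact (hz.1.resolve_left hz.2).1
    obtain ⟨h₁, h₂, h₃⟩ := main P Q hP hQ hPQ hdisj hnP
    obtain ⟨h₄, h₅, h₆⟩ := main Q P hQ hP (by rwa [union_comm]) hdisj.symm hnQ
    refine (hind _ _ h₁ h₂ h₄ h₅ ?_).elim h₃ h₆
    rw [← union_union_distrib_left, ← union_inter_distrib_right, inter_eq_right.2 hPQ, hun]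

/-- A dendroid contains no nondegenerate indecomposable continuum. -/
theorem IsDendroid.exists_decomposition {α : Type*} [MetricSpace α] {X K : Set α}
    (hX : IsDendroid X) (hKX : K ⊆ X) (hK : IsCompact K) (hKc : IsConnected K)
    (hnt : K.Nontrivial) :
    ∃ P Q : Set α, IsCompact P ∧ IsConnected P ∧ IsCompact Q ∧ IsConnected Q ∧
      P ∪ Q = K ∧ P ≠ K ∧ Q ≠ K := by
  by_contra! hcon
  have hind : ∀ P Q : Set α, IsCompact P → IsConnected P → IsCompact Q → IsConnected Q →
      P ∪ Q = K → P = K ∨ Q = K := fun P Q h₁ h₂ h₃ h₄ h₅ => by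
    by_contra! h
    exact h.2 (hcon P Q h₁ h₂ h₃ h₄ h₅ h.1)
  obtain ⟨a, ha, b₀, hb₀, hab₀⟩ := hnt
  have : CompactSpace K := isCompact_iff_compactSpace.1 hK
  have : SecondCountableTopology K := inferInstance
  have hcount := TopologicalSpace.countable_countableBasis K
  let ι := {u : Set K // u ∈ TopologicalSpace.countableBasis K ∧ u.Nonempty ∧ (⟨a, ha⟩ : K) ∉ u}
  have : Countable ι := (hcount.mono (fun u hu => hu.1)).to_subtype
  let R : ι → Set α := fun u => K \ ((↑) '' u.1)
  have hRcl : ∀ u, IsClosed (R u) := by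
    intro u
    have : R u = (↑) '' (u.1ᶜ : Set K) := by
      rw [image_compl_eq_range_sdiff_image Subtype.val_injective, Subtype.range_coe]
    rw [this]
    exact ((TopologicalSpace.isOpen_of_mem_countableBasis u.2.1).isClosed_compl.isCompact.image
      continuous_subtype_val).isClosed
  have haR : ∀ u, a ∈ R u := fun u => ⟨ha, by
    rintro ⟨y, hy, rfl⟩
    exact u.2.2.2 hy⟩
  let C : ι → Set α := fun u => connectedComponentIn (R u) a
  have hCR : ∀ u, C u ⊆ R u := fun u => connectedComponentIn_subset _ _
  have hCK : ∀ u, C u ⊆ K := fun u => (hCR u).trans sdiff_subset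
  have hCc : ∀ u, IsConnected (C u) := fun u => isConnected_connectedComponentIn_iff.2 (haR u)
  have hCcl : ∀ u, IsClosed (C u) := by
    intro u
    have h1 : closure (C u) ⊆ R u := closure_minimal (hCR u) (hRcl u)
    have h2 := (hCc u).isPreconnected.closure.subset_connectedComponentIn
      (subset_closure (mem_connectedComponentIn (haR u))) h1
    exact isClosed_of_closure_subset h2
  have hCne : ∀ u, C u ≠ K := by
    intro u h
    obtain ⟨y, hy⟩ := u.2.2.1
    exact (hCR u (h.symm.subset y.2)).2 ⟨y, hy, rfl⟩
  have hcover : ∀ b ∈ K, a ≠ b → ∃ u, b ∈ C u := by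
    intro b hb hab
    obtain ⟨T, hTX, hT⟩ := hX.2.2.2 a (hKX ha) b (hKX hb) hab
    have hTK := hT.subset_of_mem hX.2.2.1 hKX hK hKc hTX ha hb
    have hTne : T ≠ K := by
      rintro rfl
      obtain ⟨P, Q, h₁, h₂, h₃, h₄, h₅, h₆, h₇⟩ := hT.exists_decomposition
      exact h₇ (hcon P Q h₁ h₂ h₃ h₄ h₅ h₆)
    obtain ⟨y, hyK, hyT⟩ : ∃ y ∈ K, y ∉ T := by
      by_contra! h
      exact hTne (hTK.antisymm h)
    obtain ⟨u, hu, hyu, huT⟩ :=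
      (TopologicalSpace.isBasis_countableBasis K).exists_subset_of_mem_open
      (show (⟨y, hyK⟩ : K) ∈ ((↑) ⁻¹' Tᶜ : Set K) from hyT)
      (hT.isCompact.isClosed.isOpen_compl.preimage continuous_subtype_val)
    have haT : a ∈ T := by
      obtain ⟨f, -, -, rfl, rfl, -⟩ := hT
      exact mem_image_of_mem _ (left_mem_Icc.2 zero_le_one)
    have hbT : b ∈ T := by
      obtain ⟨f, -, -, rfl, -, rfl⟩ := hT
      exact mem_image_of_mem _ (right_mem_Icc.2 zero_le_one)
    refine ⟨⟨u, hu, ⟨_, hyu⟩, fun h => huT h haT⟩, ?_⟩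
    refine hT.isConnected.isPreconnected.subset_connectedComponentIn haT ?_ hbT
    rintro z hz
    refine ⟨hTK hz, ?_⟩
    rintro ⟨w, hw, rfl⟩
    exact huT hw hz
  have hcov : ⋃ u : ι, ((↑) ⁻¹' C u : Set K) = univ := by
    refine eq_univ_of_forall fun b => mem_iUnion.2 ?_
    by_cases hab : a = b
    · obtain ⟨u, -⟩ := hcover b₀ hb₀ hab₀
      refine ⟨u, ?_⟩
      rw [mem_preimage, ← hab]
      exact mem_connectedComponentIn (haR u)
    · exact hcover b b.2 hab
  have : Nonempty K := ⟨⟨a, ha⟩⟩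
  obtain ⟨u, y, hy⟩ := nonempty_interior_of_iUnion_of_closed
    (fun u => (hCcl u).preimage continuous_subtype_val) hcov
  have hdense := closure_diff_eq_of_indecomposable hK hKc hind
    (hK.of_isClosed_subset (hCcl u) (hCK u)) (hCc u) (hCK u) (hCne u)
  obtain ⟨W, hW, hWeq⟩ := isOpen_induced_iff.1 (isOpen_interior (s := ((↑) ⁻¹' C u : Set K)))
  have hyW : (y : α) ∈ W := by
    rw [← hWeq] at hy
    exact hy
  obtain ⟨z, hzW, hzK, hzC⟩ := mem_closure_iff.1 (hdense.symm.subset y.2) W hW hyW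
  have : (⟨z, hzK⟩ : K) ∈ interior ((↑) ⁻¹' C u : Set K) := by
    rw [← hWeq]
    exact hzW
  exact hzC (interior_subset (s := ((↑) ⁻¹' C u : Set K)) this)

/-- A plane dendroid does not separate the plane. -/
theorem IsDendroid.joinedIn_compl {X : Set Plane} (hX : IsDendroid X) {p q : Plane}
    (hp : p ∉ X) (hq : q ∉ X) : JoinedIn Xᶜ p q := by
  by_contra hn
  obtain ⟨K, hKX, hKcl, hKn, hmin⟩ := exists_minimal_not_joinedIn_compl hX.1 hn
  have hK : IsCompact K := hX.1.of_isClosed_subset hKcl hKX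
  have hrank : 1 < Module.rank ℝ Plane := by
    rw [← Module.finrank_eq_rank, finrank_euclideanSpace_fin]
    norm_num
  have hstep : ∀ P Q : Set Plane, IsClosed P → IsClosed Q → P ∪ Q = K → P ≠ K → Q ≠ K →
      ¬ IsPreconnected (P ∩ Q) := by
    rintro P Q hP hQ rfl hPK hQK hpre
    exact hKn (joinedIn_compl_union (hK.of_isClosed_subset hP subset_union_left)
      (hK.of_isClosed_subset hQ subset_union_right) hpre
      (hmin P subset_union_left hP hPK) (hmin Q subset_union_right hQ hQK))
  have hne : K.Nonempty := by
    by_contra h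
    rw [not_nonempty_iff_eq_empty] at h
    subst h
    rw [compl_empty, joinedIn_univ] at hKn
    exact hKn (PathConnectedSpace.joined p q)
  have hconn : IsPreconnected K := by
    rw [isPreconnected_iff_subset_of_fully_disjoint_closed hKcl]
    by_contra! h
    obtain ⟨M, N, hM, hN, hMN, hd, h₁, h₂⟩ := h
    refine hstep (K ∩ M) (K ∩ N) (hKcl.inter hM) (hKcl.inter hN) ?_
      (fun h => h₁ (inter_eq_left.1 h)) (fun h => h₂ (inter_eq_left.1 h)) ?_
    · rw [← inter_union_distrib_left, inter_eq_left.2 hMN]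
    · have : K ∩ M ∩ (K ∩ N) = ∅ := by
        rw [← inter_inter_distrib_left, disjoint_iff_inter_eq_empty.1 hd, inter_empty]
      rw [this]
      exact isPreconnected_empty
  have hnt : K.Nontrivial := by
    by_contra h
    rw [not_nontrivial_iff] at h
    obtain ⟨a, ha⟩ := hne
    have : K = {a} := h.eq_singleton_of_mem ha
    subst this
    exact hKn ((isPathConnected_compl_singleton_of_one_lt_rank hrank a).joinedIn p
      (fun h => hp (hKX h)) q (fun h => hq (hKX h)))
  obtain ⟨P, Q, h₁, h₂, h₃, h₄, rfl, h₆, h₇⟩ := hX.exists_decomposition hKX hK ⟨hne, hconn⟩ hnt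
  exact hstep P Q h₁.isClosed h₃.isClosed rfl h₆ h₇ (hX.2.2.1 P Q (subset_union_left.trans hKX)
    (subset_union_right.trans hKX) h₁ h₂ h₃ h₄)
/-- Removing from the parameter interval a maximal family of loops of a path. -/
theorem exists_loopErased {Y : Type*} [TopologicalSpace Y] [T2Space Y] {g : ℝ → Y}
    (hg : Continuous g) :
    ∃ F ⊆ Icc (0 : ℝ) 1, IsClosed F ∧ 0 ∈ F ∧ 1 ∈ F ∧
      ∀ a ∈ F, ∀ b ∈ F, a < b → (g a = g b ↔ Disjoint (Ioo a b) F) := by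
  obtain ⟨F, -, hF⟩ := zorn_superset_nonempty
    {F : Set ℝ | F ⊆ Icc 0 1 ∧ IsClosed F ∧ 0 ∈ F ∧ 1 ∈ F ∧
      ∀ a ∈ F, ∀ b ∈ F, a < b → Disjoint (Ioo a b) F → g a = g b} (fun c hc hchain hne => by
    refine ⟨⋂₀ c, ⟨?_, isClosed_sInter fun s hs => (hc hs).2.1, fun s hs => (hc hs).2.2.1,
      fun s hs => (hc hs).2.2.2.1, fun a ha b hb hab hd => ?_⟩,
      fun s hs => sInter_subset_of_mem hs⟩
    · obtain ⟨s, hs⟩ := hne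
      exact (sInter_subset_of_mem hs).trans (hc hs).1
    · by_contra hgab
      obtain ⟨U, V, hU, hV, haU, hbV, hUV⟩ := t2_separation hgab
      obtain ⟨η₁, hη₁, hball₁⟩ := Metric.isOpen_iff.1 (hU.preimage hg) a haU
      obtain ⟨η₂, hη₂, hball₂⟩ := Metric.isOpen_iff.1 (hV.preimage hg) b hbV
      obtain ⟨η, hη, hηlt⟩ := exists_between (lt_min (lt_min hη₁ hη₂) (half_pos (sub_pos.2 hab)))
      have h1 : η < η₁ := hηlt.trans_le ((min_le_left _ _).trans (min_le_left _ _))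
      have h2 : η < η₂ := hηlt.trans_le ((min_le_left _ _).trans (min_le_right _ _))
      have h3 : η < (b - a) / 2 := hηlt.trans_le (min_le_right _ _)
      have : Nonempty c := hne.to_subtype
      obtain ⟨⟨s, hs⟩, hsd⟩ := (isCompact_Icc (a := a + η) (b := b - η)).elim_directed_family_closed
        (fun s : c => (s : Set ℝ)) (fun s => (hc s.2).2.1) (by
          rw [← sInter_eq_iInter, ← disjoint_iff_inter_eq_empty]
          exact hd.mono_left (Icc_subset_Ioo (by linarith) (by linarith)))
        (by
          rintro ⟨s, hs⟩ ⟨t, ht⟩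
          rcases hchain.total hs ht with hst | hst
          · exact ⟨⟨s, hs⟩, subset_rfl, hst⟩
          · exact ⟨⟨t, ht⟩, hst, subset_rfl⟩)
      have hscl : IsClosed s := (hc hs).2.1
      obtain ⟨a', ⟨ha's, ha'⟩, hamax⟩ := (isCompact_Icc.inter_left hscl).exists_isGreatest
        (⟨a, ha s hs, left_mem_Icc.2 (by linarith)⟩ : (s ∩ Icc a (a + η)).Nonempty)
      obtain ⟨b', ⟨hb's, hb'⟩, hbmin⟩ := (isCompact_Icc.inter_left hscl).exists_isLeast
        (⟨b, hb s hs, right_mem_Icc.2 (by linarith)⟩ : (s ∩ Icc (b - η) b).Nonempty)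
      have heq : g a' = g b' := by
        refine (hc hs).2.2.2.2 a' ha's b' hb's (by linarith [ha'.2, hb'.1]) ?_
        rw [disjoint_left]
        rintro u ⟨hu₁, hu₂⟩ hus
        by_cases h4 : u ≤ a + η
        · exact absurd (hamax ⟨hus, by linarith [ha'.1], h4⟩) (not_le.2 hu₁)
        · by_cases h5 : b - η ≤ u
          · exact absurd (hbmin ⟨hus, h5, by linarith [hb'.2]⟩) (not_le.2 hu₂)
          · have : u ∈ Icc (a + η) (b - η) ∩ s := ⟨⟨by linarith, by linarith⟩, hus⟩
            rw [hsd] at this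
            exact this
      have haU' : g a' ∈ U := hball₁ (by
        rw [Metric.mem_ball, Real.dist_eq, abs_lt]
        constructor <;> linarith [ha'.1, ha'.2])
      have hbV' : g b' ∈ V := hball₂ (by
        rw [Metric.mem_ball, Real.dist_eq, abs_lt]
        constructor <;> linarith [hb'.1, hb'.2])
      exact disjoint_left.1 hUV haU' (heq ▸ hbV')) (Icc 0 1)
    ⟨subset_rfl, isClosed_Icc, by simp, by simp, fun a ha b hb hab hd => by
      obtain ⟨u, hu⟩ := nonempty_Ioo.2 hab
      exact absurd ⟨ha.1.trans hu.1.le, hu.2.le.trans hb.2⟩ (disjoint_left.1 hd hu)⟩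
  obtain ⟨hFI, hFcl, h0, h1, hgap⟩ := hF.prop
  refine ⟨F, hFI, hFcl, h0, h1, fun s hs t ht hst => ⟨fun hgst => ?_, hgap s hs t ht hst⟩⟩
  have hmem : F \ Ioo s t ∈ {F : Set ℝ | F ⊆ Icc 0 1 ∧ IsClosed F ∧ 0 ∈ F ∧ 1 ∈ F ∧
      ∀ a ∈ F, ∀ b ∈ F, a < b → Disjoint (Ioo a b) F → g a = g b} := by
    refine ⟨sdiff_subset.trans hFI, hFcl.sdiff isOpen_Ioo, ⟨h0, fun h => ?_⟩, ⟨h1, fun h => ?_⟩, ?_⟩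
    · exact absurd (hFI hs).1 (not_le.2 h.1)
    · exact absurd (hFI ht).2 (not_le.2 h.2)
    · rintro a ⟨ha, hast⟩ b ⟨hb, hbst⟩ hab hd
      have hsF : s ∈ F \ Ioo s t := ⟨hs, fun h => lt_irrefl _ h.1⟩
      have htF : t ∈ F \ Ioo s t := ⟨ht, fun h => lt_irrefl _ h.2⟩
      have hsab : ¬ (a < s ∧ s < b) := fun h => disjoint_left.1 hd h hsF
      have htab : ¬ (a < t ∧ t < b) := fun h => disjoint_left.1 hd h htF
      by_cases hd' : Disjoint (Ioo a b) F
      · exact hgap a ha b hb hab hd'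
      · obtain ⟨u, hu, huF⟩ := not_disjoint_iff.1 hd'
        have hust : u ∈ Ioo s t := by
          by_contra h
          exact disjoint_left.1 hd hu ⟨huF, h⟩
        simp only [mem_Ioo] at hast hbst hu hust
        have h3 : a = s := by grind
        have h4 : b = t := by grind
        rw [h3, h4, hgst]
  have hle := hF.le_of_le hmem sdiff_subset
  rw [disjoint_left]
  exact fun u hu huF => (hle huF).2 hu

/-- A path with distinct endpoints contains an arc with the same endpoints. -/
theorem Path.exists_isArcWithEndpoints {Y : Type*} [MetricSpace Y] {a b : Y} (γ : Path a b)
    (hab : a ≠ b) : ∃ A ⊆ range γ, IsArcWithEndpoints A a b := by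
  obtain ⟨g, hg, hgr, rfl, rfl⟩ : ∃ g : ℝ → Y, Continuous g ∧ range g = range γ ∧
      g 0 = a ∧ g 1 = b :=
    ⟨γ.extend, γ.continuous_extend, γ.extend_range, γ.extend_zero, γ.extend_one⟩
  rw [← hgr]
  have hbdd : Bornology.IsBounded (range g) := hgr ▸ (isCompact_range γ.continuous).isBounded
  obtain ⟨F, hFI, hFcl, h0, h1, hF⟩ := exists_loopErased hg
  have hFc : IsCompact F := isCompact_Icc.of_isClosed_subset hFcl hFI
  obtain ⟨D, hD⟩ := Metric.isBounded_iff.1 hbdd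
  let q : ℕ → ℝ := TopologicalSpace.denseSeq ℝ
  let G : ℝ → Set Y := fun t => g '' (F ∩ Icc 0 t)
  let d : ℕ → ℝ → ℝ := fun n t => Metric.infDist (g (q n)) (G t)
  have hGmem : ∀ {s t : ℝ}, s ∈ F → s ≤ t → g s ∈ G t := fun hs hst =>
    mem_image_of_mem _ ⟨hs, (hFI hs).1, hst⟩
  have hdanti : ∀ n, ∀ s ∈ F, ∀ t, s ≤ t → d n t ≤ d n s := fun n s hs t hst =>
    Metric.infDist_le_infDist_of_subset
      (image_mono (inter_subset_inter_right _ (Icc_subset_Icc_right hst))) ⟨_, hGmem hs le_rfl⟩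
  have hd0 : ∀ n t, 0 ≤ d n t := fun n t => Metric.infDist_nonneg
  have hdD : ∀ n, ∀ t ∈ F, d n t ≤ D := fun n t ht =>
    (Metric.infDist_le_dist_of_mem (hGmem ht le_rfl)).trans (hD ⟨_, rfl⟩ ⟨_, rfl⟩)
  have hdcont : ∀ n, ContinuousOn (d n) F := by
    intro n
    have key : ∀ ε, ∀ s ∈ F, ∀ t, s ≤ t → (∀ u ∈ Icc s t, dist (g u) (g s) ≤ ε) →
        d n s - ε ≤ d n t := by
      intro ε s hs t hst hε
      refine (Metric.le_infDist ⟨_, hGmem hs hst⟩).2 ?_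
      rintro _ ⟨u, ⟨huF, hu⟩, rfl⟩
      have hε0 : 0 ≤ ε := dist_nonneg.trans (hε s (left_mem_Icc.2 hst))
      rcases le_total u s with hus | hus
      · have := Metric.infDist_le_dist_of_mem (x := g (q n)) (hGmem huF hus)
        simp only [d]
        linarith
      · have h2 := Metric.infDist_le_dist_of_mem (x := g (q n)) (hGmem hs le_rfl)
        have h3 := hε u ⟨hus, hu.2⟩
        have h4 := dist_triangle (g (q n)) (g u) (g s)
        simp only [d]
        linarith
    rw [Metric.continuousOn_iff]
    intro t₀ ht₀ ε hε
    obtain ⟨δ, hδ, hball⟩ := Metric.continuous_iff.1 hg t₀ (ε / 4) (by positivity)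
    refine ⟨δ, hδ, fun t ht htt₀ => ?_⟩
    rw [Real.dist_eq, abs_lt] at htt₀ ⊢
    have hclose : ∀ u v : ℝ, |u - t₀| < δ → |v - t₀| < δ → dist (g u) (g v) ≤ ε / 2 := by
      intro u v hu hv
      have h2 := hball u hu
      have h3 := hball v hv
      have h4 := dist_triangle_right (g u) (g v) (g t₀)
      linarith
    rcases le_total t t₀ with h | h
    · have h2 := key (ε / 2) t ht t₀ h fun u hu => hclose u t
        (abs_lt.2 ⟨by linarith [hu.1], by linarith [hu.2]⟩) (abs_lt.2 htt₀)
      have h3 := hdanti n t ht t₀ h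
      constructor <;> linarith
    · have h2 := key (ε / 2) t₀ ht₀ t h fun u hu => hclose u t₀
        (abs_lt.2 ⟨by linarith [hu.1], by linarith [hu.2]⟩) (by simpa using hδ)
      have h3 := hdanti n t₀ ht₀ t h
      constructor <;> linarith
  let φ : ℝ → ℝ := fun t => ∑' n : ℕ, (1 / 2 : ℝ) ^ n * (D - d n t)
  have hsumm : Summable fun n : ℕ => (1 / 2 : ℝ) ^ n * D := summable_geometric_two.mul_right D
  have hterm0 : ∀ n, ∀ t ∈ F, 0 ≤ (1 / 2 : ℝ) ^ n * (D - d n t) := fun n t ht =>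
    mul_nonneg (by positivity) (sub_nonneg.2 (hdD n t ht))
  have htermD : ∀ n t, (1 / 2 : ℝ) ^ n * (D - d n t) ≤ (1 / 2 : ℝ) ^ n * D := fun n t =>
    mul_le_mul_of_nonneg_left (sub_le_self _ (hd0 n t)) (by positivity)
  have hsummφ : ∀ t ∈ F, Summable fun n : ℕ => (1 / 2 : ℝ) ^ n * (D - d n t) := fun t ht =>
    Summable.of_nonneg_of_le (fun n => hterm0 n t ht) (fun n => htermD n t) hsumm
  have hφcont : ContinuousOn φ F := by
    refine continuousOn_tsum (fun n => continuousOn_const.mul (continuousOn_const.sub (hdcont n)))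
      hsumm fun n t ht => ?_
    rw [Real.norm_of_nonneg (hterm0 n t ht)]
    exact htermD n t
  have hφeq : ∀ s ∈ F, ∀ t ∈ F, s < t → g s = g t → φ s = φ t := by
    intro s hs t ht hst hgst
    have hd := (hF s hs t ht hst).1 hgst
    have : G s = G t := by
      refine (image_mono (inter_subset_inter_right _ (Icc_subset_Icc_right hst.le))).antisymm ?_
      rintro _ ⟨u, ⟨huF, hu⟩, rfl⟩
      rcases le_or_gt u s with h | h
      · exact hGmem huF h
      · have : u = t := hu.2.antisymm (not_lt.1 fun h' => disjoint_left.1 hd ⟨h, h'⟩ huF)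
        rw [this, ← hgst]
        exact hGmem hs le_rfl
    simp only [φ, d, this]
  have hφlt : ∀ s ∈ F, ∀ t ∈ F, s < t → g s ≠ g t → φ s < φ t := by
    intro s hs t ht hst hgst
    have hnot : g t ∉ G s := by
      rintro ⟨u, ⟨huF, hu⟩, hgu⟩
      have hd := (hF u huF t ht (hu.2.trans_lt hst)).1 hgu
      rcases hu.2.eq_or_lt with h | h
      · exact hgst (h ▸ hgu)
      · exact disjoint_left.1 hd ⟨h, hst⟩ hs
    have hGc : IsCompact (G s) := (hFc.inter_right isClosed_Icc).image hg
    have hη : 0 < Metric.infDist (g t) (G s) :=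
      (hGc.isClosed.notMem_iff_infDist_pos ⟨_, hGmem hs le_rfl⟩).1 hnot
    obtain ⟨n, hn⟩ := (TopologicalSpace.denseRange_denseSeq ℝ).exists_mem_open
      ((Metric.isOpen_ball (x := g t) (ε := Metric.infDist (g t) (G s) / 2)).preimage hg)
      ⟨t, Metric.mem_ball_self (half_pos hη)⟩
    have hn' : dist (g (q n)) (g t) < Metric.infDist (g t) (G s) / 2 := hn
    refine (hsummφ s hs).tsum_lt_tsum (i := n) (fun m => ?_) ?_ (hsummφ t ht)
    · exact mul_le_mul_of_nonneg_left (sub_le_sub_left (hdanti m s hs t hst.le) _) (by positivity)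
    · refine mul_lt_mul_of_pos_left (sub_lt_sub_left ?_ _) (by positivity)
      have h2 : d n t ≤ dist (g (q n)) (g t) :=
        Metric.infDist_le_dist_of_mem (hGmem ht le_rfl)
      have h3 : Metric.infDist (g t) (G s) ≤ d n s + dist (g t) (g (q n)) :=
        Metric.infDist_le_infDist_add_dist
      rw [dist_comm] at h3
      linarith
  have hφiff : ∀ s ∈ F, ∀ t ∈ F, (φ s = φ t ↔ g s = g t) := by
    intro s hs t ht
    rcases lt_trichotomy s t with h | rfl | h
    · exact ⟨fun he => by_contra fun hne => (hφlt s hs t ht h hne).ne he, hφeq s hs t ht h⟩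
    · simp
    · exact ⟨fun he => by_contra fun hne => (hφlt t ht s hs h (Ne.symm hne)).ne he.symm,
        fun he => (hφeq t ht s hs h he.symm).symm⟩
  have h01 : φ 0 < φ 1 := hφlt 0 h0 1 h1 zero_lt_one hab
  have hsurj : ∀ c ∈ Icc (φ 0) (φ 1), ∃ t ∈ F, φ t = c := by
    intro c hc
    obtain ⟨u, ⟨huF, huc⟩, hmax⟩ := (hFc.of_isClosed_subset
      (hφcont.preimage_isClosed_of_isClosed hFcl isClosed_Iic) inter_subset_left).exists_isGreatest
      (⟨0, h0, hc.1⟩ : (F ∩ φ ⁻¹' Iic c).Nonempty)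
    obtain ⟨v, ⟨hvF, hvc⟩, hmin⟩ := (hFc.of_isClosed_subset
      (hφcont.preimage_isClosed_of_isClosed hFcl isClosed_Ici) inter_subset_left).exists_isLeast
      (⟨1, h1, hc.2⟩ : (F ∩ φ ⁻¹' Ici c).Nonempty)
    have huc : φ u ≤ c := huc
    have hvc : c ≤ φ v := hvc
    rcases lt_or_ge u v with huv | hvu
    · have hd : Disjoint (Ioo u v) F := by
        rw [disjoint_left]
        rintro w ⟨hw₁, hw₂⟩ hwF
        rcases le_total (φ w) c with h | h
        · exact absurd (hmax ⟨hwF, h⟩) (not_le.2 hw₁)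
        · exact absurd (hmin ⟨hwF, h⟩) (not_le.2 hw₂)
      have := hφeq u huF v hvF huv ((hF u huF v hvF huv).2 hd)
      exact ⟨u, huF, huc.antisymm (this ▸ hvc)⟩
    · have : φ v ≤ φ u := by
        rcases hvu.eq_or_lt with rfl | h
        · exact le_rfl
        · by_cases he : g v = g u
          · exact (hφeq v hvF u huF h he).le
          · exact (hφlt v hvF u huF h he).le
      exact ⟨u, huF, huc.antisymm (hvc.trans this)⟩
  choose! ψ hψF hψ using hsurj
  have hσcont : ContinuousOn (fun c => g (ψ c)) (Icc (φ 0) (φ 1)) := by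
    rw [continuousOn_iff_isClosed]
    intro t ht
    refine ⟨φ '' (F ∩ g ⁻¹' t), ((hFc.inter_right (ht.preimage hg)).image_of_continuousOn
      (hφcont.mono inter_subset_left)).isClosed, ?_⟩
    ext c
    refine and_congr_left fun hc => ⟨fun h => ⟨ψ c, ⟨hψF c hc, h⟩, hψ c hc⟩, ?_⟩
    rintro ⟨u, ⟨huF, hu⟩, hφu⟩
    have : g u = g (ψ c) := (hφiff u huF _ (hψF c hc)).1 (by rw [hφu, hψ c hc])
    rw [mem_preimage, ← this]
    exact hu
  have hend : ∀ t ∈ F, φ t ∈ Icc (φ 0) (φ 1) → g (ψ (φ t)) = g t := fun t ht hc =>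
    (hφiff _ (hψF _ hc) t ht).1 (hψ _ hc)
  let r : ℝ → ℝ := fun s => φ 0 + s * (φ 1 - φ 0)
  have hr : MapsTo r (Icc 0 1) (Icc (φ 0) (φ 1)) := by
    rintro s ⟨hs₀, hs₁⟩
    constructor <;> simp only [r] <;> nlinarith
  refine ⟨(fun s => g (ψ (r s))) '' Icc 0 1, ?_, fun s => g (ψ (r s)), ?_, ?_, rfl, ?_, ?_⟩
  · rintro _ ⟨s, -, rfl⟩
    exact ⟨_, rfl⟩
  · exact hσcont.comp (by fun_prop) hr
  · intro s hs t ht hst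
    have := (hφiff _ (hψF _ (hr hs)) _ (hψF _ (hr ht))).2 hst
    rw [hψ _ (hr hs), hψ _ (hr ht)] at this
    simp only [r] at this
    have h2 : (s - t) * (φ 1 - φ 0) = 0 := by linarith
    rcases mul_eq_zero.1 h2 with h | h
    · linarith
    · linarith
  · have : r 0 = φ 0 := by simp [r]
    simp only [this]
    exact hend 0 h0 (left_mem_Icc.2 h01.le)
  · have : r 1 = φ 1 := by simp [r]
    simp only [this]
    exact hend 1 h1 (right_mem_Icc.2 h01.le)

/-- Concatenating a sequence of paths that shrink to `x`. -/
theorem joinedIn_of_tendsto_paths {Y : Type*} [TopologicalSpace Y] {S : Set Y} {x : Y} {p : ℕ → Y}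
    (γ : ∀ n, Path (p n) (p (n + 1))) (hS : ∀ n t, γ n t ∈ S)
    (hlim : ∀ W ∈ 𝓝 x, ∀ᶠ n in atTop, ∀ t, γ n t ∈ W) : JoinedIn (insert x S) (p 0) x := by
  let h : ℕ → ℝ → Y := fun n => Nat.rec (fun _ => p 0)
    (fun n k s => if s ≤ n then k s else (γ n).extend (s - n)) n
  have hsucc : ∀ n s, h (n + 1) s = if s ≤ n then h n s else (γ n).extend (s - n) := fun _ _ => rfl
  have hge : ∀ n : ℕ, ∀ s : ℝ, n ≤ s → h n s = p n := by
    intro n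
    cases n with
    | zero => intro s _; rfl
    | succ n =>
      intro s hs
      push_cast at hs
      rw [hsucc, if_neg (by linarith), Path.extend_of_one_le _ (by linarith)]
  have hcont : ∀ n, Continuous (h n) := by
    intro n
    induction n with
    | zero => exact continuous_const
    | succ n ih =>
      refine Continuous.if_le ih ((γ n).continuous_extend.comp (by fun_prop)) continuous_id
        continuous_const fun s hs => ?_
      have hs' : s = n := hs
      change h n s = (γ n).extend (s - n)
      rw [hge n s hs'.ge, hs', sub_self, Path.extend_zero]
  have hstab : ∀ n m : ℕ, n ≤ m → ∀ s : ℝ, s ≤ n → h m s = h n s := by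
    intro n m hnm s hs
    induction m, hnm using Nat.le_induction with
    | base => rfl
    | succ m hm ih =>
      have : (n : ℝ) ≤ m := by exact_mod_cast hm
      rw [hsucc, if_pos (hs.trans this), ih]
  let g : ℝ → Y := fun s => h ⌈s⌉₊ s
  have hgeq : ∀ (n : ℕ) (s : ℝ), s ≤ n → g s = h n s := fun n s hs =>
    (hstab _ _ (Nat.ceil_le.2 hs) s (Nat.le_ceil s)).symm
  have hgcont : Continuous g := by
    rw [continuous_iff_continuousAt]
    intro s
    obtain ⟨n, hn⟩ := exists_nat_gt s
    refine (hcont n).continuousAt.congr ?_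
    filter_upwards [Iio_mem_nhds hn] with u hu
    exact (hgeq n u (le_of_lt hu)).symm
  have hgmem : ∀ s : ℝ, 0 ≤ s → g s ∈ range (γ ⌊s⌋₊) := by
    intro s hs
    have h1 := Nat.floor_le hs
    have h2 := Nat.lt_floor_add_one s
    rw [hgeq (⌊s⌋₊ + 1) s (by push_cast; exact h2.le), hsucc]
    split_ifs with h3
    · rw [hge _ _ h1]
      exact ⟨0, (γ _).source⟩
    · rw [← (γ ⌊s⌋₊).extend_range]
      exact ⟨_, rfl⟩
  have hnonneg : ∀ t : ℝ, t ∈ Icc (0 : ℝ) 1 → t < 1 → 0 ≤ t / (1 - t) := fun t ht h1 =>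
    div_nonneg ht.1 (by linarith)
  refine JoinedIn.ofLine (f := fun t : ℝ => if t < 1 then g (t / (1 - t)) else x) ?_ ?_ ?_ ?_
  · intro t ht
    rcases ht.2.lt_or_eq with h1 | rfl
    · refine ContinuousAt.continuousWithinAt ?_
      have : ContinuousAt (fun t : ℝ => g (t / (1 - t))) t :=
        hgcont.continuousAt.comp
          (continuousAt_id.div (continuousAt_const.sub continuousAt_id) (by simp; linarith))
      refine this.congr ?_
      filter_upwards [Iio_mem_nhds h1] with u hu
      exact (if_pos hu).symm
    · rw [ContinuousWithinAt, if_neg (lt_irrefl _)]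
      intro W hW
      obtain ⟨N, hN⟩ := eventually_atTop.1 (hlim W hW)
      have hopen : IsOpen {t : ℝ | (N : ℝ) * (1 - t) < t} :=
        isOpen_lt (by fun_prop) (by fun_prop)
      rw [mem_map]
      filter_upwards [self_mem_nhdsWithin, mem_nhdsWithin_of_mem_nhds
        (hopen.mem_nhds (show (N : ℝ) * (1 - 1) < 1 by norm_num))] with t ht htN
      rw [mem_preimage]
      split_ifs with h1
      · obtain ⟨u, hu⟩ := hgmem _ (hnonneg t ht h1)
        rw [← hu]
        refine hN _ (Nat.le_floor ?_) u
        rw [le_div_iff₀ (by linarith)]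
        exact le_of_lt htN
      · exact mem_of_mem_nhds hW
  · have h00 : g 0 = p 0 := hgeq 0 0 (by simp)
    simpa using h00
  · simp
  · rintro _ ⟨t, ht, rfl⟩
    simp only
    split_ifs with h1
    · obtain ⟨u, hu⟩ := hgmem _ (hnonneg t ht h1)
      rw [← hu]
      exact Or.inr (hS _ u)
    · exact Or.inl rfl

theorem HereditarilyUnicoherent.interior_eq_empty {X : Set Plane}
    (hX : HereditarilyUnicoherent X) : interior X = ∅ := by
  by_contra hne
  obtain ⟨x, hx⟩ := nonempty_iff_ne_empty.2 hne
  obtain ⟨ε, hε, hball⟩ := Metric.isOpen_iff.1 isOpen_interior x hx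
  obtain ⟨r, hr, hrε⟩ := exists_between hε
  let e : ℝ → Plane := fun t => x + r • !₂[Real.cos t, Real.sin t]
  have he0 : ∀ t, e t 0 = x 0 + r * Real.cos t := fun t => by simp [e]
  have he1 : ∀ t, e t 1 = x 1 + r * Real.sin t := fun t => by simp [e]
  have hcont : Continuous e := by fun_prop
  have hXe : ∀ t, e t ∈ X := by
    intro t
    refine interior_subset (hball ?_)
    rw [Metric.mem_ball, dist_eq_norm]
    simp only [e, add_sub_cancel_left, norm_smul, EuclideanSpace.norm_eq, Fin.sum_univ_two]
    simp [abs_of_pos hr, hrε]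
  have hpi := Real.pi_pos
  have hpre := hX (e '' Icc 0 Real.pi) (e '' Icc (-Real.pi) 0)
    (by rintro _ ⟨t, -, rfl⟩; exact hXe t) (by rintro _ ⟨t, -, rfl⟩; exact hXe t)
    (isCompact_Icc.image hcont) ((isConnected_Icc hpi.le).image _ hcont.continuousOn)
    (isCompact_Icc.image hcont) ((isConnected_Icc (by linarith)).image _ hcont.continuousOn)
  have hpre' := (hpre.image (fun z : Plane => z 0) (by fun_prop)).ordConnected
  have hmem₁ : x 0 + r ∈ (fun z : Plane => z 0) '' (e '' Icc 0 Real.pi ∩ e '' Icc (-Real.pi) 0) :=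
    ⟨e 0, ⟨mem_image_of_mem _ (left_mem_Icc.2 hpi.le),
      mem_image_of_mem _ (right_mem_Icc.2 (by linarith))⟩, by simp [he0]⟩
  have hee : e (-Real.pi) = e Real.pi := by simp [e]
  have hmem₂ : x 0 - r ∈ (fun z : Plane => z 0) '' (e '' Icc 0 Real.pi ∩ e '' Icc (-Real.pi) 0) :=
    ⟨e Real.pi, ⟨mem_image_of_mem _ (right_mem_Icc.2 hpi.le), hee ▸
      mem_image_of_mem _ (left_mem_Icc.2 (by linarith))⟩, by simp [he0, sub_eq_add_neg]⟩
  obtain ⟨z, ⟨⟨s, hs, hsz⟩, ⟨t, ht, htz⟩⟩, hz0⟩ :=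
    hpre'.out hmem₂ hmem₁ (show x 0 ∈ _ from ⟨by linarith, by linarith⟩)
  simp only at hz0
  have h1 : 0 ≤ Real.sin s := Real.sin_nonneg_of_nonneg_of_le_pi hs.1 hs.2
  have h2 : Real.sin t ≤ 0 := Real.sin_nonpos_of_nonpos_of_neg_pi_le ht.2 ht.1
  have h3 : x 1 + r * Real.sin s = x 1 + r * Real.sin t := by rw [← he1, ← he1, hsz, htz]
  have h4 : Real.sin s = 0 := by nlinarith
  have h5 : r * Real.cos s = 0 := by
    have := he0 s
    rw [hsz, hz0] at this
    linarith
  have h6 : Real.cos s = 0 := (mul_eq_zero.1 h5).resolve_left hr.ne'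
  have := Real.sin_sq_add_cos_sq s
  rw [h4, h6] at this
  norm_num at this

/-- The complement of a plane dendroid is locally path connected at a point of colocal
connectedness. -/
theorem IsDendroid.exists_ball_joinedIn {X : Set Plane} (hX : IsDendroid X) {x : Plane}
    (hcoloc : ∀ V : Set Plane, IsOpen V → x ∈ V →
      ∃ U : Set Plane, IsOpen U ∧ U ⊆ V ∧ x ∈ U ∧ IsPreconnected (X \ U))
    {ε : ℝ} (hε : 0 < ε) :
    ∃ δ > 0, ∀ p ∈ Metric.ball x δ, ∀ q ∈ Metric.ball x δ, p ∉ X → q ∉ X →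
      JoinedIn (Metric.ball x ε \ X) p q := by
  obtain ⟨U, hU, hUV, hxU, hpre⟩ := hcoloc _ Metric.isOpen_ball (Metric.mem_ball_self hε)
  obtain ⟨δ, hδ, hball⟩ := Metric.isOpen_iff.1 hU x hxU
  refine ⟨δ, hδ, fun p hp q hq hpX hqX => ?_⟩
  have hUs : Disjoint U (Metric.sphere x ε) :=
    disjoint_left.2 fun z hz hzs => (Metric.mem_ball.1 (hUV hz)).ne hzs
  have hB : IsCompact (X \ U ∪ Metric.sphere x ε) := (hX.1.diff hU).union (isCompact_sphere x ε)
  have hXB : X ∩ (X \ U ∪ Metric.sphere x ε) = X \ U := by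
    ext z
    constructor
    · rintro ⟨hzX, hz | hz⟩
      · exact hz
      · exact ⟨hzX, fun h => disjoint_left.1 hUs h hz⟩
    · exact fun hz => ⟨hz.1, Or.inl hz⟩
  have hjB : JoinedIn (X \ U ∪ Metric.sphere x ε)ᶜ p q := by
    refine ((Metric.isPathConnected_ball hδ).joinedIn p hp q hq).mono fun z hz => ?_
    rintro (h | h)
    · exact h.2 (hball hz)
    · exact disjoint_left.1 hUs (hball hz) h
  obtain ⟨γ, hγ⟩ := joinedIn_compl_union hX.1 hB (by rwa [hXB]) (hX.joinedIn_compl hpX hqX) hjB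
  have hsub : range γ ⊆ Metric.ball x ε := by
    refine (isPreconnected_range γ.continuous).subset_left_of_subset_union Metric.isOpen_ball
      (Metric.isClosed_closedBall (x := x) (ε := ε)).isOpen_compl ?_ ?_
      ⟨p, ⟨0, γ.source⟩, hUV (hball hp)⟩
    · exact disjoint_compl_right.mono_left Metric.ball_subset_closedBall
    · rintro _ ⟨t, rfl⟩
      rcases lt_trichotomy (dist (γ t) x) ε with h | h | h
      · exact Or.inl h
      · exact absurd (Or.inr (Or.inr h)) (hγ t)
      · exact Or.inr (not_le.2 h)
  exact ⟨γ, fun t => ⟨hsub ⟨t, rfl⟩, fun h => hγ t (Or.inl h)⟩⟩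

/-- Theorem: colocal connectedness implies accessibility. -/
theorem stmt_3 (X : Set Plane) (hX : IsDendroid X) (x : Plane) (hx : x ∈ X)
    (hcoloc : ∀ V : Set Plane, IsOpen V → x ∈ V →
      ∃ U : Set Plane, IsOpen U ∧ U ⊆ V ∧ x ∈ U ∧ IsPreconnected (X \ U)) :
    AccessiblePoint X x := by
  have hpos : ∀ n : ℕ, (0 : ℝ) < 1 / ((n : ℝ) + 1) := fun n => Nat.one_div_pos_of_nat
  choose δ hδ hjoin using fun n : ℕ => hX.exists_ball_joinedIn hcoloc (hpos n)
  have hp : ∀ n : ℕ, ∃ p, p ∉ X ∧ ∀ k ≤ n, p ∈ Metric.ball x (δ k) := by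
    intro n
    have hev : ∀ᶠ p in 𝓝 x, ∀ k ∈ Iic n, p ∈ Metric.ball x (δ k) :=
      (eventually_all_finite (finite_Iic n)).2 fun k _ => Metric.ball_mem_nhds x (hδ k)
    have hfreq : ∃ᶠ p in 𝓝 x, p ∈ Xᶜ := by
      rw [← mem_closure_iff_frequently, closure_compl, hX.2.2.1.interior_eq_empty, compl_empty]
      exact mem_univ x
    exact (hfreq.and_eventually hev).exists
  choose p hpX hpball using hp
  choose γ hγ using fun n => hjoin n (p n) (hpball n n le_rfl) (p (n + 1))
    (hpball (n + 1) n n.le_succ) (hpX n) (hpX (n + 1))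
  have hj : JoinedIn (insert x Xᶜ) (p 0) x := by
    refine joinedIn_of_tendsto_paths γ (fun n t => (hγ n t).2) fun W hW => ?_
    obtain ⟨ε, hε, hball⟩ := Metric.mem_nhds_iff.1 hW
    obtain ⟨N, hN⟩ := exists_nat_one_div_lt hε
    filter_upwards [eventually_ge_atTop N] with n hn t
    exact hball (Metric.ball_subset_ball ((Nat.one_div_le_one_div hn).trans hN.le) (hγ n t).1)
  obtain ⟨Γ, hΓ⟩ := hj
  have hne : p 0 ≠ x := fun h => hpX 0 (h ▸ hx)
  obtain ⟨A, hA, harc⟩ := Γ.exists_isArcWithEndpoints hne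
  refine ⟨A, ⟨_, _, harc⟩, ?_⟩
  ext z
  constructor
  · rintro ⟨hzA, hzX⟩
    obtain ⟨t, rfl⟩ := hA hzA
    exact (hΓ t).resolve_right fun h => h hzX
  · rintro rfl
    obtain ⟨f, -, -, rfl, -, hf⟩ := harc
    exact ⟨⟨1, right_mem_Icc.2 zero_le_one, hf⟩, hx⟩
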